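/- Let n ≥ 6 be an even integer and let G0 be a graph on n vertices such that there exist vertices x, y with degree 0 in G0 and such that the graph obtained from G0 by deleting x and y admits a Hamilton cycle. Then in the saturation game (G0, PM), where PM is the property of admitting a perfect matching, Max as the second player has a strategy guaranteeing that the graph at the end of the game has at least C(n−2,2) edges; in particular s(G0, PM) ≥ C(n−2,2). -/

import Mathlib

open SimpleGraph

/-- The graph obtained from `G` by adding the edge `e`. -/
def addEdge {V : Type*} (G : SimpleGraph V) (e : Sym2 V) : SimpleGraph V :=
  G ⊔ SimpleGraph.fromEdgeSet {e}

/-- In the saturation game for the monotone property `P`, a move `e` is legal in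
position `G` if `e` is a non-loop non-edge of `G` whose addition keeps `P` unsatisfied. -/
def legalMove {V : Type*} (P : SimpleGraph V → Prop) (G : SimpleGraph V) (e : Sym2 V) : Prop :=
  ¬ e.IsDiag ∧ e ∉ G.edgeSet ∧ ¬ P (addEdge G e)

/-- `GameEnsures P Q turn G` : in the saturation game for the property `P`, played from
position `G` where the protagonist is to move iff `turn = true`, the protagonist has a
strategy guaranteeing that the final (`P`-saturated) graph satisfies `Q`. -/
inductive GameEnsures {V : Type*} (P Q : SimpleGraph V → Prop) : Bool → SimpleGraph V → Prop
  | gameOver (turn : Bool) (G : SimpleGraph V)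
      (hend : ∀ e, ¬ legalMove P G e) (hQ : Q G) : GameEnsures P Q turn G
  | protagonistMove (G : SimpleGraph V) (e : Sym2 V) (hl : legalMove P G e)
      (h : GameEnsures P Q false (addEdge G e)) : GameEnsures P Q true G
  | opponentMove (G : SimpleGraph V) (e₀ : Sym2 V) (hl : legalMove P G e₀)
      (h : ∀ e, legalMove P G e → GameEnsures P Q true (addEdge G e)) :
      GameEnsures P Q false G

/-- The property of admitting a perfect matching. -/
def hasPerfectMatching {V : Type*} (G : SimpleGraph V) : Prop :=
  ∃ M : G.Subgraph, M.IsPerfectMatching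

theorem le_addEdge {V : Type*} (G : SimpleGraph V) (e : Sym2 V) : G ≤ addEdge G e :=
  le_sup_left

theorem lt_addEdge_of_legalMove {V : Type*} {P : SimpleGraph V → Prop} {G : SimpleGraph V}
    {e : Sym2 V} (h : legalMove P G e) : G < addEdge G e := by
  refine lt_of_le_of_ne (le_addEdge G e) fun heq => h.2.1 ?_
  rw [heq, addEdge, edgeSet_sup, edgeSet_fromEdgeSet]
  exact Or.inr ⟨rfl, h.1⟩

theorem addEdge_adj {V : Type*} {G : SimpleGraph V} {u v a b : V} :
    (addEdge G s(u, v)).Adj a b ↔ G.Adj a b ∨ (s(a, b) = s(u, v) ∧ a ≠ b) := by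
  simp [addEdge]

/-- If every graph reachable at the end of the game satisfies `Q`, then the protagonist
may play arbitrarily. -/
theorem gameEnsures_of_forall_saturated {V : Type*} [Finite V] {P Q : SimpleGraph V → Prop}
    (t : Bool) (G : SimpleGraph V) (hP : ¬ P G)
    (h : ∀ G', G ≤ G' → ¬ P G' → (∀ e, ¬ legalMove P G' e) → Q G') :
    GameEnsures P Q t G := by
  induction G using WellFoundedGT.induction generalizing t with
  | ind G ih =>
    by_cases hend : ∀ e, ¬ legalMove P G e
    · exact .gameOver t G hend (h G le_rfl hP hend)
    · push Not at hend
      obtain ⟨e₀, he₀⟩ := hend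
      have next (e : Sym2 V) (he : legalMove P G e) (t : Bool) :
          GameEnsures P Q t (addEdge G e) :=
        ih _ (lt_addEdge_of_legalMove he) t he.2.2
          fun G' hG' => h G' ((le_addEdge G e).trans hG')
      cases t with
      | true => exact .protagonistMove G e₀ he₀ (next e₀ he₀ _)
      | false => exact .opponentMove G e₀ he₀ fun e he => next e he _

theorem not_hasPerfectMatching_of_isolated {V : Type*} {G : SimpleGraph V} {y : V}
    (hy : ∀ v, ¬ G.Adj y v) : ¬ hasPerfectMatching G := by
  rintro ⟨M, hM⟩
  obtain ⟨w, hw, -⟩ := hM.1 (hM.2 y)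
  exact hy w hw.adj_sub

theorem hasPerfectMatching_of_pairing {n : ℕ} (hne : Even n) {G : SimpleGraph (Fin n)}
    (q : ℕ → Fin n) (hinj : Set.InjOn q (Set.Iio n))
    (hadj : ∀ i, 2 * i + 1 < n → G.Adj (q (2 * i)) (q (2 * i + 1))) :
    hasPerfectMatching G := by
  have hsurj (v : Fin n) : ∃ i < n, q i = v := by
    have hb : Function.Injective fun i : Fin n => q i := fun i j hij =>
      Fin.ext (hinj i.2 j.2 hij)
    obtain ⟨i, hi⟩ := (Finite.injective_iff_surjective.1 hb) v
    exact ⟨i, i.2, hi⟩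
  obtain ⟨k, hk⟩ := hne
  let M : G.Subgraph :=
    { verts := Set.univ
      Adj := fun a b => ∃ i, 2 * i + 1 < n ∧
        ((a = q (2 * i) ∧ b = q (2 * i + 1)) ∨ (b = q (2 * i) ∧ a = q (2 * i + 1)))
      adj_sub := by
        rintro a b ⟨i, hi, ⟨rfl, rfl⟩ | ⟨rfl, rfl⟩⟩
        · exact hadj i hi
        · exact (hadj i hi).symm
      edge_vert := fun _ => Set.mem_univ _
      symm := ⟨by
        rintro a b ⟨i, hi, h⟩
        exact ⟨i, hi, h.symm⟩⟩ }
  refine ⟨M, Subgraph.isPerfectMatching_iff.2 fun v => ?_⟩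
  obtain ⟨j, hj, rfl⟩ := hsurj v
  have inj {a b : ℕ} (h : q a = q b) (ha : a < n) (hb : b < n) : a = b := hinj ha hb h
  obtain ⟨i, rfl | rfl⟩ := Nat.even_or_odd' j
  · refine ⟨q (2 * i + 1), ⟨i, by omega, Or.inl ⟨rfl, rfl⟩⟩, ?_⟩
    rintro w ⟨i', hi', ⟨h, rfl⟩ | ⟨rfl, h⟩⟩
    · have := inj h hj (by omega)
      rw [this]
    · have := inj h hj (by omega)
      omega
  · refine ⟨q (2 * i), ⟨i, by omega, Or.inr ⟨rfl, rfl⟩⟩, ?_⟩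
    rintro w ⟨i', hi', ⟨h, rfl⟩ | ⟨rfl, h⟩⟩
    · have := inj h hj (by omega)
      omega
    · have := inj h hj (by omega)
      rw [show i = i' by omega]

/-- The `m`-periodic sequence `f` traverses a closed walk of `G` that visits
`m` distinct vertices. -/
structure IsCyclicTraversal {V : Type*} (G : SimpleGraph V) (m : ℕ) (f : ℕ → V) : Prop where
  periodic : ∀ i, f (i + m) = f i
  modEq : ∀ i j, f i = f j → i ≡ j [MOD m]
  adj : ∀ i, G.Adj (f i) (f (i + 1))

theorem IsCyclicTraversal.mono {V : Type*} {G G' : SimpleGraph V} {m : ℕ} {f : ℕ → V}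
    (hf : IsCyclicTraversal G m f) (h : G ≤ G') : IsCyclicTraversal G' m f :=
  ⟨hf.periodic, hf.modEq, fun i => h (hf.adj i)⟩

theorem IsCyclicTraversal.shift {V : Type*} {G : SimpleGraph V} {m : ℕ} {f : ℕ → V}
    (hf : IsCyclicTraversal G m f) (k : ℕ) : IsCyclicTraversal G m fun i => f (k + i) :=
  ⟨fun i => by rw [← add_assoc, hf.periodic], fun i j h => Nat.ModEq.add_left_cancel' k (hf.modEq _ _ h),
    fun i => hf.adj (k + i)⟩

/-- A vertex adjacent to two consecutive vertices of a cycle can be inserted between them. -/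
theorem IsCyclicTraversal.insert {V : Type*} {G : SimpleGraph V} {m : ℕ} (hm : 0 < m)
    {f : ℕ → V} (hf : IsCyclicTraversal G m f) {x : V} (hx : ∀ i, f i ≠ x)
    (h0 : G.Adj x (f 0)) (h1 : G.Adj x (f 1)) :
    IsCyclicTraversal G (m + 1)
      fun i => if i % (m + 1) = 0 then x else f (i % (m + 1)) := by
  refine ⟨fun i => by simp, fun i j h => ?_, fun i => ?_⟩
  · have hi : i % (m + 1) < m + 1 := Nat.mod_lt i (Nat.succ_pos m)
    have hj : j % (m + 1) < m + 1 := Nat.mod_lt j (Nat.succ_pos m)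
    unfold Nat.ModEq
    split_ifs at h with hi0 hj0 hj0
    · rw [hi0, hj0]
    · exact absurd h.symm (hx _)
    · exact absurd h (hx _)
    · have key := (hf.modEq _ _ h)
      generalize i % (m + 1) = r at *
      generalize j % (m + 1) = s at *
      have : r - 1 ≡ s - 1 [MOD m] := Nat.ModEq.add_right_cancel' 1 (by
        rwa [Nat.sub_add_cancel (by omega), Nat.sub_add_cancel (by omega)])
      have := this.eq_of_lt_of_lt (by omega) (by omega)
      omega
  · have hi : i % (m + 1) < m + 1 := Nat.mod_lt i (Nat.succ_pos m)
    have hs : (i + 1) % (m + 1) = if i % (m + 1) = m then 0 else i % (m + 1) + 1 := by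
      split_ifs with h
      · rw [Nat.add_mod, h, Nat.mod_eq_of_lt (a := 1) (by omega), Nat.mod_self]
      · rw [Nat.add_mod, Nat.mod_eq_of_lt (a := 1) (by omega), Nat.mod_eq_of_lt (by omega)]
    simp only [hs]
    generalize i % (m + 1) = r at *
    by_cases hr : r = m
    · subst hr
      have := hf.periodic 0
      rw [zero_add] at this
      simpa [hm.ne', this] using h0.symm
    · by_cases hr0 : r = 0
      · simpa [hr0, hm.ne] using h1
      · simpa [hr, hr0] using hf.adj r

theorem hasPerfectMatching_of_isCyclicTraversal {n m : ℕ} (hne : Even n)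
    {G : SimpleGraph (Fin n)} {f : ℕ → Fin n} (hf : IsCyclicTraversal G m f) (hmn : n - 2 ≤ m)
    {a b : Fin n} (hab : G.Adj a b) (ha : ∀ i < n - 2, f i ≠ a) (hb : ∀ i < n - 2, f i ≠ b) :
    hasPerfectMatching G := by
  refine hasPerfectMatching_of_pairing hne
    (fun i => if i = 0 then a else if i = 1 then b else f (i - 2)) ?_ fun i hi => ?_
  · intro i hi j hj h
    simp only [Set.mem_Iio] at hi hj h
    split_ifs at h with h1 h2 h3 h4 h5 h6 h7 h8
    · omega
    · exact absurd h hab.ne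
    · exact absurd h.symm (ha _ (by omega))
    · exact absurd h.symm hab.ne
    · omega
    · exact absurd h.symm (hb _ (by omega))
    · exact absurd h (ha _ (by omega))
    · exact absurd h (hb _ (by omega))
    · have := (hf.modEq _ _ h).eq_of_lt_of_lt (by omega) (by omega)
      omega
  · obtain _ | i := i
    · simpa using hab
    · have := hf.adj (2 * i)
      simpa [mul_add, add_assoc] using this

theorem exists_isCyclicTraversal_of_isHamiltonianCycle {V : Type*} [Fintype V] [DecidableEq V]
    {G : SimpleGraph V} {s : Set V} {a : s} {p : (G.induce s).Walk a a}
    (hp : p.IsHamiltonianCycle) :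
    ∃ f : ℕ → V, IsCyclicTraversal G s.ncard f ∧ Set.range f = s := by
  classical
  have hlen : p.length = s.ncard := by
    rw [hp.length_eq, ← Nat.card_eq_fintype_card, Nat.card_coe_set_eq]
  have h3 := hp.isCycle.three_le_length
  rw [← hlen]
  have hmod (i : ℕ) : i % p.length < p.length := Nat.mod_lt _ (by omega)
  refine ⟨fun i => (p.getVert (i % p.length)).1, ⟨fun i => by simp, fun i j h => ?_, fun i => ?_⟩,
    ?_⟩
  · exact hp.isCycle.getVert_injOn' (Nat.le_sub_one_of_lt (hmod i))
      (Nat.le_sub_one_of_lt (hmod j)) (Subtype.ext h)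
  · have hadj := p.adj_getVert_succ (hmod i)
    have hs : p.getVert ((i + 1) % p.length) = p.getVert (i % p.length + 1) := by
      by_cases h : i % p.length + 1 = p.length
      · rw [Nat.add_mod, Nat.mod_eq_of_lt (a := 1) (by omega), h, Nat.mod_self]
        simp
      · have := hmod i
        rw [Nat.add_mod, Nat.mod_eq_of_lt (a := 1) (by omega), Nat.mod_eq_of_lt (by omega)]
    simp only [hs]
    exact hadj
  · ext v
    refine ⟨?_, fun hv => ?_⟩
    · rintro ⟨i, rfl⟩
      exact Subtype.coe_prop _
    · obtain ⟨i, hi, hle⟩ := Walk.mem_support_iff_exists_getVert.1 (hp.mem_support ⟨v, hv⟩)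
      rcases hle.eq_or_lt with rfl | hlt
      · exact ⟨0, by simpa using congrArg Subtype.val hi⟩
      · exact ⟨i, by simp [Nat.mod_eq_of_lt hlt, hi]⟩

theorem choose_two_ncard_le_ncard_edgeSet {V : Type*} [Finite V] {G : SimpleGraph V} {s : Set V}
    (h : G.IsClique s) : s.ncard.choose 2 ≤ G.edgeSet.ncard := by
  classical
  have hs : s.Finite := s.toFinite
  rw [Set.ncard_eq_toFinset_card s hs, ← Sym2.card_image_offDiag, ← Set.ncard_coe_finset]
  refine Set.ncard_le_ncard ?_ (Set.toFinite _)
  intro e he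
  simp only [Finset.coe_image, Set.mem_image, Finset.mem_coe, Finset.mem_offDiag,
    Set.Finite.mem_toFinset] at he
  obtain ⟨⟨a, b⟩, ⟨ha, hb, hab⟩, rfl⟩ := he
  exact h ha hb hab

/-- Once `x` is adjacent to two consecutive vertices of the cycle while `y` is still isolated,
`y` stays isolated until the end of the game. -/
theorem gameEnsures_of_adj_consecutive {n : ℕ} (hne : Even n) (hn : 6 ≤ n)
    {G : SimpleGraph (Fin n)} {x y : Fin n} (hxy : x ≠ y) (hy : ∀ v, ¬ G.Adj y v) {f : ℕ → Fin n}
    (hf : IsCyclicTraversal G (n - 2) f) (hrange : Set.range f = {x, y}ᶜ)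
    (h0 : G.Adj x (f 0)) (h1 : G.Adj x (f 1)) (t : Bool) :
    GameEnsures hasPerfectMatching (fun G => G.IsClique {x, y}ᶜ) t G := by
  refine gameEnsures_of_forall_saturated t G (not_hasPerfectMatching_of_isolated hy)
    fun G' hG hP hend => ?_
  have hmem (i : ℕ) : f i ≠ x ∧ f i ≠ y := by
    have : f i ∈ ({x, y}ᶜ : Set (Fin n)) := hrange ▸ Set.mem_range_self i
    simpa using this
  have hy' (v : Fin n) : ¬ G'.Adj y v := by
    intro hv
    have hg := (hf.mono hG).insert (by omega) (fun i => (hmem i).1) (hG h0) (hG h1)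
    rw [show n - 2 + 1 = n - 1 by omega] at hg
    set g : ℕ → Fin n := fun i => if i % (n - 1) = 0 then x else f (i % (n - 1)) with hgdef
    have hgy (i : ℕ) : g i ≠ y := by
      simp only [hgdef]
      split_ifs
      · exact hxy
      · exact (hmem _).2
    obtain ⟨j, rfl⟩ : ∃ j, g j = v := by
      by_cases hvx : v = x
      · exact ⟨0, by simp [hgdef, hvx]⟩
      · have : v ∈ Set.range f := by
          rw [hrange]
          simp [hvx, hv.ne']
        obtain ⟨i, rfl⟩ := this
        have hlt : i % (n - 2) < n - 2 := Nat.mod_lt _ (by omega)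
        have hper : f (i % (n - 2)) = f i := Function.Periodic.map_mod_nat hf.periodic i
        by_cases hi : i % (n - 2) = 0
        · refine ⟨n - 2, ?_⟩
          simp only [hgdef]
          rw [Nat.mod_eq_of_lt (by omega), if_neg (by omega), ← hper, hi]
          simpa using hf.periodic 0
        · refine ⟨i % (n - 2), ?_⟩
          simp only [hgdef]
          rw [Nat.mod_eq_of_lt (by omega), if_neg hi, hper]
    refine hP (hasPerfectMatching_of_isCyclicTraversal hne (hg.shift (j + 1))
      (by omega) hv (fun i _ => hgy _) fun i hi h => ?_)
    have : j + (1 + i) ≡ j + 0 [MOD (n - 1)] := by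
      simpa [add_assoc] using hg.modEq _ _ h
    have := (Nat.ModEq.add_left_cancel' j this).eq_of_lt_of_lt (by omega) (by omega)
    omega
  intro u hu v hv huv
  by_contra hnadj
  refine hend s(u, v) ⟨by simpa using huv, by simpa using hnadj,
    not_hasPerfectMatching_of_isolated (y := y) fun w hw => ?_⟩
  simp only [Set.mem_compl_iff, Set.mem_insert_iff, Set.mem_singleton_iff, not_or] at hu hv
  rcases addEdge_adj.1 hw with h | ⟨h, -⟩
  · exact hy' w h
  · rcases Sym2.eq_iff.1 h with ⟨h, -⟩ | ⟨h, -⟩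
    · exact hu.2 h.symm
    · exact hv.2 h.symm

/-- The answer to an edge joining the isolated vertex `x` to the cycle is to join `x` to the
next vertex of the cycle. -/
theorem gameEnsures_of_addEdge_isolated {n : ℕ} (hne : Even n) (hn : 6 ≤ n)
    {G : SimpleGraph (Fin n)} {x y : Fin n} (hxy : x ≠ y) (hx : ∀ v, ¬ G.Adj x v)
    (hy : ∀ v, ¬ G.Adj y v) {f : ℕ → Fin n} (hf : IsCyclicTraversal G (n - 2) f)
    (hrange : Set.range f = {x, y}ᶜ) {u : Fin n} (hux : u ≠ x) (huy : u ≠ y) :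
    GameEnsures hasPerfectMatching (fun G => G.IsClique {x, y}ᶜ) true (addEdge G s(x, u)) := by
  have hmem (i : ℕ) : f i ≠ x ∧ f i ≠ y := by
    have : f i ∈ ({x, y}ᶜ : Set (Fin n)) := hrange ▸ Set.mem_range_self i
    simpa using this
  obtain ⟨k, rfl⟩ : u ∈ Set.range f := by
    rw [hrange]
    simp [hux, huy]
  have hne1 : f (k + 1) ≠ f k := (hf.adj k).ne'
  have hy2 (v : Fin n) : ¬ (addEdge (addEdge G s(x, f k)) s(x, f (k + 1))).Adj y v := by
    simp [addEdge_adj, hy, hxy.symm, (hmem _).2.symm]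
  refine .protagonistMove _ s(x, f (k + 1)) ⟨?_, ?_, not_hasPerfectMatching_of_isolated hy2⟩ ?_
  · simpa using (hmem _).1.symm
  · simp [addEdge_adj, hx, hne1, (hmem _).1.symm, (hmem _).1]
  · refine gameEnsures_of_adj_consecutive hne hn hxy hy2
      ((hf.mono ((le_addEdge _ _).trans (le_addEdge _ _))).shift k) ?_ ?_ ?_ false
    · rw [← hrange]
      refine Set.Subset.antisymm ?_ ?_
      · rintro _ ⟨i, rfl⟩
        exact ⟨k + i, rfl⟩
      · rintro _ ⟨i, rfl⟩
        have h : f (i + k * (n - 2)) = f i := by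
          simpa using Function.Periodic.nsmul hf.periodic k i
        refine ⟨i + k * (n - 2) - k, ?_⟩
        have : k ≤ k * (n - 2) := Nat.le_mul_of_pos_right k (by omega)
        simp only
        rw [← h]
        congr 1
        omega
    · simp [addEdge_adj, (hmem _).1.symm]
    · simp [addEdge_adj, (hmem _).1.symm]

theorem gameEnsures_isClique_of_isolated {n : ℕ} (hne : Even n) (hn : 6 ≤ n)
    (G : SimpleGraph (Fin n)) {x y : Fin n} (hxy : x ≠ y) (hx : ∀ v, ¬ G.Adj x v)
    (hy : ∀ v, ¬ G.Adj y v) {f : ℕ → Fin n} (hf : IsCyclicTraversal G (n - 2) f)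
    (hrange : Set.range f = {x, y}ᶜ) :
    GameEnsures hasPerfectMatching (fun G => G.IsClique {x, y}ᶜ) false G := by
  induction G using WellFoundedGT.induction with
  | ind G ih =>
    have hmem (i : ℕ) : f i ≠ x ∧ f i ≠ y := by
      have : f i ∈ ({x, y}ᶜ : Set (Fin n)) := hrange ▸ Set.mem_range_self i
      simpa using this
    have isolated_addEdge {H : SimpleGraph (Fin n)} {z u v : Fin n} (hz : ∀ w, ¬ H.Adj z w)
        (hu : z ≠ u) (hv : z ≠ v) (w : Fin n) : ¬ (addEdge H s(u, v)).Adj z w := by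
      simp [addEdge_adj, hz, hu, hv]
    have of_isClique {H : SimpleGraph (Fin n)} {t : Bool} (hH : H.IsClique {x, y}ᶜ)
        (hy : ∀ w, ¬ H.Adj y w) :
        GameEnsures hasPerfectMatching (fun G => G.IsClique {x, y}ᶜ) t H :=
      gameEnsures_of_forall_saturated t H (not_hasPerfectMatching_of_isolated hy)
        fun G' hG' _ _ => hH.mono hG'
    have exists_move {H : SimpleGraph (Fin n)} (hH : ¬ H.IsClique {x, y}ᶜ)
        (hy : ∀ w, ¬ H.Adj y w) : ∃ u v, u ≠ x ∧ u ≠ y ∧ v ≠ x ∧ v ≠ y ∧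
          legalMove hasPerfectMatching H s(u, v) := by
      simp only [isClique_iff, Set.Pairwise, Set.mem_compl_iff, Set.mem_insert_iff,
        Set.mem_singleton_iff, not_forall, not_or] at hH
      obtain ⟨u, ⟨hux, huy⟩, v, ⟨hvx, hvy⟩, huv, hnadj⟩ := hH
      exact ⟨u, v, hux, huy, hvx, hvy, by simpa using huv, by simpa using hnadj,
        not_hasPerfectMatching_of_isolated (isolated_addEdge hy (Ne.symm huy) (Ne.symm hvy))⟩
    by_cases hG : G.IsClique {x, y}ᶜ
    · exact of_isClique hG hy
    obtain ⟨u₀, v₀, -, -, -, -, hlegal⟩ := exists_move hG hy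
    refine .opponentMove G _ hlegal fun e he => ?_
    induction e using Sym2.ind with
    | _ u v =>
      have huv : u ≠ v := by simpa using he.1
      have not_xy : s(u, v) ≠ s(x, y) := by
        intro h
        rw [h] at he
        refine he.2.2 (hasPerfectMatching_of_isCyclicTraversal hne
          (hf.mono (le_addEdge _ _)) le_rfl (a := x) (b := y) ?_
          (fun i _ => (hmem i).1) fun i _ => (hmem i).2)
        simp [addEdge_adj, hxy]
      have answer_x (w : Fin n) (hwx : w ≠ x) (hwy : w ≠ y) :=
        gameEnsures_of_addEdge_isolated hne hn hxy hx hy hf hrange hwx hwy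
      have answer_y (w : Fin n) (hwx : w ≠ x) (hwy : w ≠ y) :
          GameEnsures hasPerfectMatching (fun G => G.IsClique {x, y}ᶜ) true
            (addEdge G s(y, w)) := by
        have := gameEnsures_of_addEdge_isolated hne hn hxy.symm hy hx hf
          (by rw [hrange, Set.pair_comm]) hwy hwx
        rwa [Set.pair_comm] at this
      by_cases hux : u = x
      · subst hux
        exact answer_x v huv.symm fun h => not_xy (by rw [h])
      by_cases huy : u = y
      · subst huy
        exact answer_y v (fun h => not_xy (by rw [h, Sym2.eq_swap])) huv.symm
      by_cases hvx : v = x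
      · subst hvx
        rw [Sym2.eq_swap]
        exact answer_x u hux huy
      by_cases hvy : v = y
      · subst hvy
        rw [Sym2.eq_swap]
        exact answer_y u hux huy
      have hx1 := isolated_addEdge hx (Ne.symm hux) (Ne.symm hvx)
      have hy1 := isolated_addEdge hy (Ne.symm huy) (Ne.symm hvy)
      by_cases hG1 : (addEdge G s(u, v)).IsClique {x, y}ᶜ
      · exact of_isClique hG1 hy1
      obtain ⟨a, b, hax, hay, hbx, hby, hab⟩ := exists_move hG1 hy1
      exact .protagonistMove _ _ hab (ih _
        ((lt_addEdge_of_legalMove he).trans (lt_addEdge_of_legalMove hab))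
        (isolated_addEdge hx1 hax.symm hbx.symm) (isolated_addEdge hy1 hay.symm hby.symm)
        (hf.mono ((le_addEdge _ _).trans (le_addEdge _ _))))

theorem GameEnsures.imp {V : Type*} {P Q Q' : SimpleGraph V → Prop} (h : ∀ G, Q G → Q' G)
    {t : Bool} {G : SimpleGraph V} (hG : GameEnsures P Q t G) : GameEnsures P Q' t G := by
  induction hG with
  | gameOver t G hend hQ => exact .gameOver t G hend (h G hQ)
  | protagonistMove G e hl _ ih => exact .protagonistMove G e hl ih
  | opponentMove G e₀ hl _ ih => exact .opponentMove G e₀ hl ih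

/-- Let `n ≥ 6` be even and let `G0` be a graph on `n` vertices having two isolated
vertices `x ≠ y` such that `G0 - x - y` has a Hamilton cycle. Then in the saturation
game `(G0, PM)`, Max, moving second, can guarantee a final score of at least
`C(n-2, 2)`. -/
theorem statement_18 (n : ℕ) (hn : 6 ≤ n) (hne : Even n) (G0 : SimpleGraph (Fin n))
    (x y : Fin n) (hxy : x ≠ y)
    (hx : G0.neighborSet x = ∅) (hy : G0.neighborSet y = ∅)
    (hham : ∃ (a : ({x, y}ᶜ : Set (Fin n)))
      (p : (G0.induce ({x, y}ᶜ : Set (Fin n))).Walk a a), p.IsHamiltonianCycle) :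
    GameEnsures hasPerfectMatching
      (fun G : SimpleGraph (Fin n) => (n - 2).choose 2 ≤ G.edgeSet.ncard)
      false G0 := by
  have hcard : ({x, y}ᶜ : Set (Fin n)).ncard = n - 2 := by
    rw [Set.ncard_compl, Set.ncard_pair hxy, Nat.card_fin]
  obtain ⟨a, p, hp⟩ := hham
  obtain ⟨f, hf, hrange⟩ := exists_isCyclicTraversal_of_isHamiltonianCycle hp
  rw [hcard] at hf
  refine (gameEnsures_isClique_of_isolated hne hn G0 hxy (fun v hv => ?_) (fun v hv => ?_)
    hf hrange).imp fun G hG => ?_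
  · exact (hx ▸ (G0.mem_neighborSet x v).2 hv : v ∈ (∅ : Set (Fin n)))
  · exact (hy ▸ (G0.mem_neighborSet y v).2 hv : v ∈ (∅ : Set (Fin n)))
  · rw [← hcard]
    exact choose_two_ncard_le_ncard_edgeSet hG
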